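/- Assume f ≠ 0 and let r be a positive integer. Then m_f ∈ W, and for every W-submodule S of the left W-module (Fin r → W) and every L ∈ (Fin r → W), the following are equivalent: (1) there exists j : ℕ such that (fun i => m_f^j ∘ L i) ∈ S; (2) the element (fun i => (L i : Module.End K Q)) lies in the A-submodule N of (Fin r → A) given by N := Submodule.span A (image of S under the componentwise inclusion W ⊆ A) + Submodule.span A {m_{f·T − 1} · e_k | k ∈ Fin r}, where e_k is the k-th standard basis vector (so m_{f·T − 1} · e_k has entry m_{f·T − 1} in component k and 0 elsewhere). -/

import Mathlib

set_option synthInstance.maxHeartbeats 1000000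
set_option maxHeartbeats 1000000

open MvPolynomial

noncomputable section

variable (K : Type*) [Field K] [CharZero K] (n : ℕ)

/-- The polynomial ring `K[x₁,…,xₙ,T]`. -/
abbrev Qring := MvPolynomial (Fin n ⊕ Unit) K

/-- The operator of multiplication by a polynomial `q`. -/
def mQ (q : Qring K n) : Module.End K (Qring K n) := LinearMap.mulLeft K q

/-- The variable `T`. -/
def Tvar : Qring K n := X (Sum.inr ())

/-- The twisted partial derivative `D_i = ∂_{x_i} - m_{f_i·T²} ∘ ∂_T`. -/
def Dop (f : Qring K n) (i : Fin n) : Module.End K (Qring K n) :=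
  (pderiv (R := K) (Sum.inl i)).toLinearMap -
    mQ K n (pderiv (Sum.inl i) f * Tvar K n ^ 2) * (pderiv (R := K) (Sum.inr ())).toLinearMap

/-- The realization of the Weyl algebra `W_x`, generated by the `m_{x_i}` and the `D_i`. -/
def Wsub (f : Qring K n) : Subalgebra K (Module.End K (Qring K n)) :=
  Algebra.adjoin K
    ((Set.range fun i : Fin n => mQ K n (X (Sum.inl i))) ∪ Set.range (Dop K n f))

/-- The realization of the extended algebra `W_x[T]`, generated by the `m_{x_i}`,
the `D_i` and `m_T`. -/
def Asub (f : Qring K n) : Subalgebra K (Module.End K (Qring K n)) :=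
  Algebra.adjoin K
    ((Set.range fun i : Fin n => mQ K n (X (Sum.inl i))) ∪ Set.range (Dop K n f) ∪
      {mQ K n (Tvar K n)})

set_option linter.unusedSectionVars false

theorem mQ_apply (p q : Qring K n) : mQ K n p q = p * q := rfl

theorem Dop_apply (f : Qring K n) (i : Fin n) (q : Qring K n) :
    Dop K n f i q = pderiv (Sum.inl i) q -
      pderiv (Sum.inl i) f * Tvar K n ^ 2 * pderiv (Sum.inr ()) q := rfl

/-- The inclusion `K[x₁,…,xₙ] → K[x₁,…,xₙ,T]`. -/
abbrev inclX : MvPolynomial (Fin n) K →ₐ[K] Qring K n := rename Sum.inl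

theorem pderiv_inr_inclX (p : MvPolynomial (Fin n) K) :
    pderiv (Sum.inr ()) (inclX K n p) = 0 := by
  classical
  refine pderiv_eq_zero_of_notMem_vars fun h => ?_
  simpa using vars_rename Sum.inl p h

theorem exists_inclX_eq (f : Qring K n) (hfT : pderiv (Sum.inr ()) f = 0) :
    ∃ p, inclX K n p = f := by
  refine exists_rename_eq_of_vars_subset_range f Sum.inl Sum.inl_injective ?_
  rintro (i | ⟨⟩) h
  · exact ⟨i, rfl⟩
  · exfalso
    obtain ⟨m, hm, hi⟩ := (mem_vars_iff_mem_support _).1 h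
    have hle : Finsupp.single (Sum.inr ()) 1 ≤ m :=
      Finsupp.single_le_iff.2 (Nat.one_le_iff_ne_zero.2 (Finsupp.mem_support_iff.1 hi))
    have h0 := coeff_pderiv (i := Sum.inr ()) f (m - Finsupp.single (Sum.inr ()) 1)
    rw [hfT, coeff_zero, tsub_add_cancel_of_le hle, eq_comm, mul_eq_zero] at h0
    exact h0.elim (mem_support_iff.1 hm) (Nat.cast_add_one_ne_zero _)

theorem Dop_inclX (f : Qring K n) (i : Fin n) (p : MvPolynomial (Fin n) K) :
    Dop K n f i (inclX K n p) = inclX K n (pderiv i p) := by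
  rw [Dop_apply, pderiv_inr_inclX, mul_zero, sub_zero, pderiv_rename Sum.inl_injective]

theorem Dop_mul (f : Qring K n) (i : Fin n) (p q : Qring K n) :
    Dop K n f i (p * q) = Dop K n f i p * q + p * Dop K n f i q := by
  simp only [Dop_apply, pderiv_mul]
  ring

theorem Dop_Tvar (f : Qring K n) (i : Fin n) :
    Dop K n f i (Tvar K n) = -(pderiv (Sum.inl i) f * Tvar K n ^ 2) := by
  simp [Dop_apply, Tvar]

theorem Dop_eq_pderiv (f : Qring K n) (hfT : pderiv (Sum.inr ()) f = 0) (i : Fin n) :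
    Dop K n f i f = pderiv (Sum.inl i) f := by
  simp [Dop_apply, hfT]

theorem Dop_one (f : Qring K n) (i : Fin n) : Dop K n f i 1 = 0 := by
  simp [Dop_apply]

theorem Dop_rabinowitsch_mul (f : Qring K n) (hfT : pderiv (Sum.inr ()) f = 0) (i : Fin n)
    (q : Qring K n) :
    Dop K n f i ((f * Tvar K n - 1) * q) =
      (f * Tvar K n - 1) * (Dop K n f i q - pderiv (Sum.inl i) f * Tvar K n * q) := by
  rw [Dop_mul, map_sub, Dop_mul, Dop_one, Dop_eq_pderiv K n f hfT, Dop_Tvar]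
  ring

theorem mul_Dop_pow (f : Qring K n) (hfT : pderiv (Sum.inr ()) f = 0) (i : Fin n) (k : ℕ) :
    f * Dop K n f i (f ^ k) = k * pderiv (Sum.inl i) f * f ^ k := by
  induction k with
  | zero => simp [Dop_one]
  | succ k ih =>
    rw [pow_succ, Dop_mul, Dop_eq_pderiv K n f hfT]
    push_cast
    linear_combination f * ih

section Subalgebras

variable {K n}

theorem mQ_X_mem_Wsub (f : Qring K n) (i : Fin n) : mQ K n (X (Sum.inl i)) ∈ Wsub K n f :=
  Algebra.subset_adjoin (Or.inl ⟨i, rfl⟩)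

theorem Dop_mem_Wsub (f : Qring K n) (i : Fin n) : Dop K n f i ∈ Wsub K n f :=
  Algebra.subset_adjoin (Or.inr ⟨i, rfl⟩)

theorem Wsub_le_Asub (f : Qring K n) : Wsub K n f ≤ Asub K n f :=
  Algebra.adjoin_mono Set.subset_union_left

theorem mQ_Tvar_mem_Asub (f : Qring K n) : mQ K n (Tvar K n) ∈ Asub K n f :=
  Algebra.subset_adjoin (Or.inr rfl)

theorem mQ_inclX_mem_Wsub (f : Qring K n) (p : MvPolynomial (Fin n) K) :
    mQ K n (inclX K n p) ∈ Wsub K n f := by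
  have key : ((Algebra.lmul K (Qring K n)).comp (inclX K n)).range ≤ Wsub K n f := by
    rw [← Algebra.map_top, ← MvPolynomial.adjoin_range_X, AlgHom.map_adjoin, Algebra.adjoin_le_iff]
    rintro _ ⟨_, ⟨i, rfl⟩, rfl⟩
    change mQ K n (inclX K n (X i)) ∈ _
    rw [rename_X]
    exact mQ_X_mem_Wsub f i
  exact key ⟨p, rfl⟩

theorem mQ_mul (p q : Qring K n) : mQ K n (p * q) = mQ K n p * mQ K n q :=
  LinearMap.mulLeft_mul K _ p q

theorem mQ_pow (p : Qring K n) (m : ℕ) : mQ K n (p ^ m) = mQ K n p ^ m :=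
  (LinearMap.pow_mulLeft K _ p m).symm

theorem mQ_pow_mem_Wsub (f : Qring K n) (hfT : pderiv (Sum.inr ()) f = 0) (m : ℕ) :
    mQ K n (f ^ m) ∈ Wsub K n f := by
  obtain ⟨p, hp⟩ := exists_inclX_eq K n f hfT
  rw [mQ_pow]
  exact pow_mem (hp ▸ mQ_inclX_mem_Wsub _ p) m

theorem mQ_rabinowitsch_mem_Asub (f : Qring K n) (hf : mQ K n f ∈ Wsub K n f) :
    mQ K n (f * Tvar K n - 1) ∈ Asub K n f := by
  have : mQ K n (f * Tvar K n - 1) = mQ K n f * mQ K n (Tvar K n) - 1 := by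
    exact LinearMap.ext fun q => by simp [mQ_apply, sub_mul, mul_assoc]
  rw [this]
  exact sub_mem (mul_mem (Wsub_le_Asub f hf) (mQ_Tvar_mem_Asub f)) (one_mem _)

theorem Asub_induction (f : Qring K n) {P : Module.End K (Qring K n) → Prop}
    (hx : ∀ i, P (mQ K n (X (Sum.inl i)))) (hD : ∀ i, P (Dop K n f i))
    (hT : P (mQ K n (Tvar K n))) (halg : ∀ c, P (algebraMap K _ c))
    (hadd : ∀ a b, P a → P b → P (a + b)) (hmul : ∀ a b, P a → P b → P (a * b))
    {a : Module.End K (Qring K n)} (ha : a ∈ Asub K n f) : P a := by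
  refine Algebra.adjoin_induction ?_ halg (fun a b _ _ => hadd a b) (fun a b _ _ => hmul a b) ha
  rintro _ ((⟨i, rfl⟩ | ⟨i, rfl⟩) | rfl)
  exacts [hx i, hD i, hT]

theorem dvd_apply_of_dvd (f : Qring K n) (hfT : pderiv (Sum.inr ()) f = 0)
    {a : Module.End K (Qring K n)} (ha : a ∈ Asub K n f) :
    ∀ q, f * Tvar K n - 1 ∣ q → f * Tvar K n - 1 ∣ a q := by
  refine Asub_induction f (P := fun a => ∀ q, f * Tvar K n - 1 ∣ q → f * Tvar K n - 1 ∣ a q)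
    (fun i q h => h.mul_left _) ?_ (fun q h => h.mul_left _) (fun c q h => ?_)
    (fun a b iha ihb q h => dvd_add (iha q h) (ihb q h)) (fun a b iha ihb q h => iha _ (ihb q h)) ha
  · rintro i _ ⟨q, rfl⟩
    exact ⟨_, Dop_rabinowitsch_mul K n f hfT i q⟩
  · rw [Module.algebraMap_end_apply]
    exact dvd_smul_of_dvd c h

theorem exists_rabinowitsch_mul_eq (f : Qring K n) (hfT : pderiv (Sum.inr ()) f = 0)
    {a : Module.End K (Qring K n)} (ha : a ∈ Asub K n f) :
    ∃ b ∈ Asub K n f, mQ K n (f * Tvar K n - 1) * a = b * mQ K n (f * Tvar K n - 1) := by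
  refine Asub_induction f (P := fun a => ∃ b ∈ Asub K n f,
    mQ K n (f * Tvar K n - 1) * a = b * mQ K n (f * Tvar K n - 1)) (fun i => ?_) (fun i => ?_)
    ?_ (fun c => ?_) ?_ ?_ ha
  · exact ⟨_, Wsub_le_Asub f (mQ_X_mem_Wsub f i), by rw [← mQ_mul, mul_comm, mQ_mul]⟩
  · obtain ⟨p, hp⟩ := exists_inclX_eq K n f hfT
    have hfi : mQ K n (pderiv (Sum.inl i) f) ∈ Wsub K n f := by
      rw [← hp, pderiv_rename Sum.inl_injective]
      exact mQ_inclX_mem_Wsub _ _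
    refine ⟨_, add_mem (Wsub_le_Asub f (Dop_mem_Wsub f i))
      (mul_mem (Wsub_le_Asub f hfi) (mQ_Tvar_mem_Asub f)), ?_⟩
    refine LinearMap.ext fun q => ?_
    simp only [Module.End.mul_apply, LinearMap.add_apply, mQ_apply, Dop_rabinowitsch_mul K n f hfT]
    ring
  · exact ⟨_, mQ_Tvar_mem_Asub f, by rw [← mQ_mul, mul_comm, mQ_mul]⟩
  · exact ⟨_, algebraMap_mem _ c, (Algebra.commutes c _).symm⟩
  · rintro a b ⟨a', ha', haa⟩ ⟨b', hb', hbb⟩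
    exact ⟨_, add_mem ha' hb', by rw [mul_add, add_mul, haa, hbb]⟩
  · rintro a b ⟨a', ha', haa⟩ ⟨b', hb', hbb⟩
    exact ⟨_, mul_mem ha' hb', by rw [← mul_assoc, haa, mul_assoc, hbb, mul_assoc]⟩

/-- An Ore condition modulo the operators with values in the ideal `(f * T - 1)`. -/
theorem exists_pow_mul_sub_dvd (f : Qring K n) (hfT : pderiv (Sum.inr ()) f = 0)
    {a : Module.End K (Qring K n)} (ha : a ∈ Asub K n f) :
    ∀ k : ℕ, ∃ M : ℕ, ∃ w ∈ Wsub K n f, ∀ q, f * Tvar K n - 1 ∣ f ^ M * a q - w (f ^ k * q) := by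
  obtain ⟨p, hp⟩ := exists_inclX_eq K n f hfT
  have hpow := mQ_pow_mem_Wsub f hfT
  refine Asub_induction f (P := fun a => ∀ k : ℕ, ∃ M : ℕ, ∃ w ∈ Wsub K n f,
    ∀ q, f * Tvar K n - 1 ∣ f ^ M * a q - w (f ^ k * q)) (fun i k => ?_) (fun i k => ?_)
    (fun k => ?_) (fun c k => ?_) ?_ ?_ ha
  · refine ⟨k, _, mQ_X_mem_Wsub f i, fun q => ?_⟩
    simp [mQ_apply, mul_left_comm]
  · have hfi : mQ K n (pderiv (Sum.inl i) f) ∈ Wsub K n f := by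
      rw [← hp, pderiv_rename Sum.inl_injective]
      exact mQ_inclX_mem_Wsub _ _
    refine ⟨k + 1, _, sub_mem (mul_mem (hp ▸ mQ_inclX_mem_Wsub _ p) (Dop_mem_Wsub f i))
      (nsmul_mem hfi k), fun q => ?_⟩
    have hk := mul_Dop_pow K n f hfT i k
    simp only [LinearMap.sub_apply, Module.End.mul_apply, LinearMap.smul_apply, mQ_apply, Dop_mul]
    rw [nsmul_eq_mul]
    convert dvd_zero _ using 1
    linear_combination -q * hk
  · refine ⟨k + 1, 1, one_mem _, fun q => ⟨f ^ k * q, ?_⟩⟩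
    simp only [mQ_apply, Module.End.one_apply]
    ring
  · refine ⟨k, _, algebraMap_mem _ c, fun q => ?_⟩
    simp [Module.algebraMap_end_apply]
  · intro a b iha ihb k
    obtain ⟨M, w, hw, h⟩ := iha k
    obtain ⟨M', w', hw', h'⟩ := ihb k
    refine ⟨M + M', _, add_mem (mul_mem (hpow M') hw) (mul_mem (hpow M) hw'), fun q => ?_⟩
    convert ((h q).mul_left (f ^ M')).add ((h' q).mul_left (f ^ M)) using 1
    simp only [LinearMap.add_apply, Module.End.mul_apply, mQ_apply]
    ring
  · intro a b iha ihb k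
    obtain ⟨M', w', hw', h'⟩ := ihb k
    obtain ⟨M, w, hw, h⟩ := iha M'
    refine ⟨M, _, mul_mem hw hw', fun q => ?_⟩
    convert (h (b q)).add (dvd_apply_of_dvd f hfT (Wsub_le_Asub f hw) _ (h' q)) using 1
    simp only [Module.End.mul_apply, map_sub]
    ring

end Subalgebras

section Expansion

/-- A derivation acting on the coefficients of power series. -/
def coeffDerivation {R : Type*} [CommRing R] [Algebra K R] (d : Derivation K R R) :
    Derivation K (PowerSeries R) (PowerSeries R) :=
  Derivation.mk'
    { toFun := fun F => PowerSeries.mk fun k => d (PowerSeries.coeff k F)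
      map_add' := fun F G => by ext k; simp
      map_smul' := fun c F => by ext k; simp }
    fun F G => by
      ext k
      simp only [LinearMap.coe_mk, AddHom.coe_mk, PowerSeries.coeff_mk, smul_eq_mul, map_add,
        PowerSeries.coeff_mul, map_sum, Derivation.leibniz, Finset.sum_add_distrib]
      congr 1
      rw [Finset.Nat.sum_antidiagonal_swap.symm]
      rfl

variable {K}

theorem coeff_coeffDerivation {R : Type*} [CommRing R] [Algebra K R] (d : Derivation K R R)
    (k : ℕ) (F : PowerSeries R) :
    PowerSeries.coeff k (coeffDerivation K d F) = d (PowerSeries.coeff k F) := by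
  simp [coeffDerivation]

theorem coeffDerivation_C {R : Type*} [CommRing R] [Algebra K R] (d : Derivation K R R) (a : R) :
    coeffDerivation K d (PowerSeries.C a) = PowerSeries.C (d a) := by
  ext k
  rw [coeff_coeffDerivation, PowerSeries.coeff_C, PowerSeries.coeff_C]
  split_ifs <;> simp

theorem coeffDerivation_X {R : Type*} [CommRing R] [Algebra K R] (d : Derivation K R R) :
    coeffDerivation K d (PowerSeries.X : PowerSeries R) = 0 := by
  ext k
  rw [coeff_coeffDerivation, PowerSeries.coeff_X]
  split_ifs <;> simp

variable {n}

/-- The power series `z / (1 + p z) = 1 / (p + z⁻¹)`. -/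
def shiftedInv (p : MvPolynomial (Fin n) K) : PowerSeries (MvPolynomial (Fin n) K) :=
  PowerSeries.X * PowerSeries.mk fun k => (-p) ^ k

theorem shiftedInv_mul (p : MvPolynomial (Fin n) K) :
    shiftedInv p * (1 + PowerSeries.C p * PowerSeries.X) = PowerSeries.X := by
  rw [shiftedInv, mul_assoc]
  convert mul_one _
  ext k
  rcases k with _ | k
  · simp
  · rw [mul_add, mul_one, map_add, mul_left_comm, PowerSeries.coeff_C_mul,
      PowerSeries.coeff_succ_mul_X]
    simp [PowerSeries.coeff_one, pow_succ, mul_comm]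

theorem shiftedInv_ne_zero (p : MvPolynomial (Fin n) K) : shiftedInv p ≠ 0 := fun h =>
  PowerSeries.X_ne_zero (by rw [← shiftedInv_mul p, h, zero_mul])

theorem coeffDerivation_shiftedInv (p : MvPolynomial (Fin n) K)
    (d : Derivation K (MvPolynomial (Fin n) K) (MvPolynomial (Fin n) K)) :
    coeffDerivation K d (shiftedInv p) = -(PowerSeries.C (d p) * shiftedInv p ^ 2) := by
  have h := congrArg (coeffDerivation K d) (shiftedInv_mul p)
  simp only [Derivation.leibniz, map_add, Derivation.map_one_eq_zero, coeffDerivation_C,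
    coeffDerivation_X, smul_eq_mul] at h
  have hne : (1 + PowerSeries.C p * PowerSeries.X : PowerSeries (MvPolynomial (Fin n) K)) ≠ 0 :=
    fun h0 => PowerSeries.X_ne_zero (by rw [← shiftedInv_mul p, h0, mul_zero])
  apply mul_left_cancel₀ hne
  linear_combination h + PowerSeries.C (d p) * shiftedInv p * shiftedInv_mul p

/-- The expansion of a polynomial in `x` and `T` after substituting `T = 1 / (p + z⁻¹)`. -/
def expandT (p : MvPolynomial (Fin n) K) : Qring K n →ₐ[K] PowerSeries (MvPolynomial (Fin n) K) :=
  aeval (Sum.elim (fun i => PowerSeries.C (X i)) fun _ => shiftedInv p)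

theorem expandT_X (p : MvPolynomial (Fin n) K) (i : Fin n) :
    expandT p (X (Sum.inl i)) = PowerSeries.C (X i) :=
  (aeval_X _ _).trans rfl

theorem expandT_Tvar (p : MvPolynomial (Fin n) K) : expandT p (Tvar K n) = shiftedInv p :=
  (aeval_X _ _).trans rfl

theorem expandT_inclX (p g : MvPolynomial (Fin n) K) :
    expandT p (inclX K n g) = PowerSeries.C g := by
  induction g using MvPolynomial.induction_on with
  | C a =>
    rw [rename_C, ← algebraMap_eq, AlgHom.commutes, PowerSeries.algebraMap_apply, algebraMap_eq]
  | add a b ha hb => simp only [map_add, ha, hb]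
  | mul_X a i ha => rw [map_mul, map_mul, map_mul, ha, rename_X, expandT_X]

theorem expandT_Dop (p : MvPolynomial (Fin n) K) (i : Fin n) (q : Qring K n) :
    expandT p (Dop K n (inclX K n p) i q) = coeffDerivation K (pderiv i) (expandT p q) := by
  induction q using MvPolynomial.induction_on with
  | C a =>
    rw [← algebraMap_eq, AlgHom.commutes, Derivation.map_algebraMap]
    simp [Dop_apply, algebraMap_eq]
  | add a b ha hb => simp only [map_add, ha, hb]
  | mul_X a j ha =>
    rw [Dop_mul, map_add, map_mul, map_mul, map_mul, ha, Derivation.leibniz]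
    have key : expandT p (Dop K n (inclX K n p) i (X j)) =
        coeffDerivation K (pderiv i) (expandT p (X j)) := by
      rcases j with j | ⟨⟩
      · rw [expandT_X, coeffDerivation_C, ← rename_X (f := Sum.inl), Dop_inclX, expandT_inclX]
      · change expandT p (Dop K n (inclX K n p) i (Tvar K n)) =
          coeffDerivation K (pderiv i) (expandT p (Tvar K n))
        rw [Dop_Tvar, expandT_Tvar, coeffDerivation_shiftedInv, pderiv_rename Sum.inl_injective,
          map_neg, map_mul, map_pow, expandT_inclX, expandT_Tvar]
    rw [key, smul_eq_mul, smul_eq_mul]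
    ring

theorem exists_eq_inclX_add_Tvar_mul (q : Qring K n) :
    ∃ p q', q = inclX K n p + Tvar K n * q' := by
  induction q using MvPolynomial.induction_on with
  | C a => exact ⟨C a, 0, by simp⟩
  | add a b ha hb =>
    obtain ⟨p, a', rfl⟩ := ha
    obtain ⟨s, b', rfl⟩ := hb
    exact ⟨p + s, a' + b', by rw [map_add]; ring⟩
  | mul_X a j ha =>
    obtain ⟨p, a', rfl⟩ := ha
    rcases j with j | ⟨⟩
    · exact ⟨p * X j, a' * X (Sum.inl j), by rw [map_mul, rename_X]; ring⟩
    · exact ⟨0, inclX K n p + Tvar K n * a', by rw [map_zero, Tvar]; ring⟩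

theorem expandT_injective (p : MvPolynomial (Fin n) K) : Function.Injective (expandT p) := by
  rw [injective_iff_map_eq_zero]
  intro q
  induction hd : q.totalDegree using Nat.strong_induction_on generalizing q with
  | _ d ih =>
    intro hq
    obtain ⟨g, q', rfl⟩ := exists_eq_inclX_add_Tvar_mul q
    have hg : g = 0 := by
      have := congrArg (PowerSeries.coeff 0) hq
      simpa [expandT_inclX, expandT_Tvar, shiftedInv] using this
    subst hg
    rw [map_zero, zero_add] at hq hd ⊢
    by_contra hne
    have hT := left_ne_zero_of_mul hne
    have hq' := right_ne_zero_of_mul hne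
    rw [totalDegree_mul_of_isDomain hT hq', Tvar, totalDegree_X] at hd
    rw [map_mul, expandT_Tvar] at hq
    exact hq' (ih _ (by omega) q' rfl ((mul_eq_zero.1 hq).resolve_left (shiftedInv_ne_zero p)))

/-- The `k`-th coefficient of `expandT p`, as an operator on `K[x₁,…,xₙ,T]`. -/
def expandTCoeff (p : MvPolynomial (Fin n) K) (k : ℕ) : Module.End K (Qring K n) :=
  (inclX K n).toLinearMap ∘ₗ ((PowerSeries.coeff k).restrictScalars K) ∘ₗ (expandT p).toLinearMap

theorem expandTCoeff_apply (p : MvPolynomial (Fin n) K) (k : ℕ) (q : Qring K n) :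
    expandTCoeff p k q = inclX K n (PowerSeries.coeff k (expandT p q)) := rfl

theorem Wsub_commute_expandTCoeff (p : MvPolynomial (Fin n) K) (k : ℕ)
    {w : Module.End K (Qring K n)} (hw : w ∈ Wsub K n (inclX K n p)) (q : Qring K n) :
    expandTCoeff p k (w q) = w (expandTCoeff p k q) := by
  have hle : Wsub K n (inclX K n p) ≤ Subalgebra.centralizer K {expandTCoeff p k} := by
    refine Algebra.adjoin_le ?_
    rintro _ (⟨i, rfl⟩ | ⟨i, rfl⟩) <;> refine (Subalgebra.mem_centralizer_iff K).2 ?_ <;>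
      rintro _ rfl <;> refine LinearMap.ext fun q => ?_
    · simp only [Module.End.mul_apply, expandTCoeff_apply, mQ_apply, map_mul, expandT_X,
        PowerSeries.coeff_C_mul, rename_X]
    · simp only [Module.End.mul_apply, expandTCoeff_apply, expandT_Dop, coeff_coeffDerivation,
        Dop_inclX]
  exact LinearMap.congr_fun ((Subalgebra.mem_centralizer_iff K).1 (hle hw) _ rfl) q

/-- `W` acts faithfully on `K[x₁,…,xₙ]`. -/
theorem eq_zero_of_apply_inclX_eq_zero (p : MvPolynomial (Fin n) K)
    {w : Module.End K (Qring K n)} (hw : w ∈ Wsub K n (inclX K n p))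
    (h : ∀ g, w (inclX K n g) = 0) : w = 0 := by
  refine LinearMap.ext fun q => expandT_injective p (PowerSeries.ext fun k => ?_)
  refine rename_injective (Sum.inl : Fin n → Fin n ⊕ Unit) Sum.inl_injective ?_
  have := Wsub_commute_expandTCoeff p k hw q
  rw [expandTCoeff_apply, expandTCoeff_apply, h] at this
  simpa using this

theorem exists_apply_inclX_eq_inclX (p : MvPolynomial (Fin n) K)
    {w : Module.End K (Qring K n)} (hw : w ∈ Wsub K n (inclX K n p)) (g : MvPolynomial (Fin n) K) :
    ∃ g', w (inclX K n g) = inclX K n g' := by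
  refine Algebra.adjoin_induction (p := fun w _ => ∀ g, ∃ g', w (inclX K n g) = inclX K n g')
    ?_ (fun c g => ⟨c • g, ?_⟩) ?_ ?_ hw g
  · rintro _ (⟨i, rfl⟩ | ⟨i, rfl⟩) g
    · exact ⟨X i * g, by rw [mQ_apply, map_mul, rename_X]⟩
    · exact ⟨_, Dop_inclX K n _ i g⟩
  · rw [Module.algebraMap_end_apply, map_smul]
  · rintro a b - - iha ihb g
    obtain ⟨g₁, h₁⟩ := iha g
    obtain ⟨g₂, h₂⟩ := ihb g
    exact ⟨g₁ + g₂, by rw [LinearMap.add_apply, h₁, h₂, map_add]⟩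
  · rintro a b - - iha ihb g
    obtain ⟨g₁, h₁⟩ := ihb g
    obtain ⟨g₂, h₂⟩ := iha g₁
    exact ⟨g₂, by rw [Module.End.mul_apply, h₁, h₂]⟩

theorem inclX_eq_zero_of_dvd (p : MvPolynomial (Fin n) K) (hp : p ≠ 0)
    (g : MvPolynomial (Fin n) K) (h : inclX K n p * Tvar K n - 1 ∣ inclX K n g) : g = 0 := by
  let ι := algebraMap (MvPolynomial (Fin n) K) (FractionRing (MvPolynomial (Fin n) K))
  let φ : Qring K n →ₐ[K] FractionRing (MvPolynomial (Fin n) K) :=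
    aeval (Sum.elim (fun i => ι (X i)) fun _ => (ι p)⁻¹)
  have hι : Function.Injective ι := IsFractionRing.injective _ _
  have hφ (s : MvPolynomial (Fin n) K) : φ (inclX K n s) = ι s := by
    induction s using MvPolynomial.induction_on with
    | C a =>
      rw [rename_C, ← algebraMap_eq, AlgHom.commutes, ← algebraMap_eq]
      exact IsScalarTower.algebraMap_apply _ _ _ a
    | add a b ha hb => simp only [map_add, ha, hb]
    | mul_X a i ha => simp [ha, φ]
  have hT : φ (Tvar K n) = (ι p)⁻¹ := by simp [φ, Tvar]
  have h0 := map_dvd φ h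
  rw [map_sub, map_mul, hφ, hφ, hT, mul_inv_cancel₀ ((map_ne_zero_iff ι hι).2 hp), map_one, sub_self,
    zero_dvd_iff] at h0
  exact (map_eq_zero_iff ι hι).1 h0

/-- A nonzero element of `W` does not map `K[x₁,…,xₙ,T]` into the ideal `(f * T - 1)`. -/
theorem eq_zero_of_forall_dvd (f : Qring K n) (hf : f ≠ 0) (hfT : pderiv (Sum.inr ()) f = 0)
    {w : Module.End K (Qring K n)} (hw : w ∈ Wsub K n f) (h : ∀ q, f * Tvar K n - 1 ∣ w q) :
    w = 0 := by
  obtain ⟨p, rfl⟩ := exists_inclX_eq K n f hfT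
  refine eq_zero_of_apply_inclX_eq_zero p hw fun g => ?_
  obtain ⟨g', hg'⟩ := exists_apply_inclX_eq_inclX p hw g
  rw [hg', inclX_eq_zero_of_dvd p (fun h0 => hf (by rw [h0, map_zero])) g' (hg' ▸ h _), map_zero]

end Expansion

section Saturation

variable {K n} {r : ℕ}

/-- The vectors of operators that some power of `f` carries into `S`, up to operators with values
in the ideal `(f * T - 1)`. -/
def saturationModulo (f : Qring K n) (hfT : pderiv (Sum.inr ()) f = 0)
    (S : Submodule (Wsub K n f) (Fin r → Wsub K n f)) :
    Submodule (Asub K n f) (Fin r → Asub K n f) where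
  carrier := {v | ∃ M : ℕ, ∃ s ∈ S, ∀ i q, f * Tvar K n - 1 ∣
    f ^ M * (v i : Module.End K (Qring K n)) q - (s i : Module.End K (Qring K n)) q}
  zero_mem' := ⟨0, 0, S.zero_mem, fun i q => by simp⟩
  add_mem' := by
    rintro v v' ⟨M, s, hs, h⟩ ⟨M', s', hs', h'⟩
    refine ⟨M + M', _, S.add_mem (S.smul_mem ⟨_, mQ_pow_mem_Wsub f hfT M'⟩ hs)
      (S.smul_mem ⟨_, mQ_pow_mem_Wsub f hfT M⟩ hs'), fun i q => ?_⟩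
    convert ((h i q).mul_left (f ^ M')).add ((h' i q).mul_left (f ^ M)) using 1
    simp only [Pi.add_apply, Pi.smul_apply, smul_eq_mul, Subalgebra.coe_add, Subalgebra.coe_mul,
      LinearMap.add_apply, Module.End.mul_apply, mQ_apply]
    ring
  smul_mem' := by
    rintro a v ⟨M, s, hs, h⟩
    obtain ⟨M', w, hw, h'⟩ := exists_pow_mul_sub_dvd f hfT a.2 M
    refine ⟨M', _, S.smul_mem ⟨w, hw⟩ hs, fun i q => ?_⟩
    convert (h' ((v i : Module.End K (Qring K n)) q)).add
      (dvd_apply_of_dvd f hfT (Wsub_le_Asub f hw) _ (h i q)) using 1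
    simp only [Pi.smul_apply, smul_eq_mul, Subalgebra.coe_mul, Module.End.mul_apply, map_sub]
    ring

theorem rabinowitsch_mul_mem_span (f : Qring K n) (hfT : pderiv (Sum.inr ()) f = 0)
    (hu : mQ K n (f * Tvar K n - 1) ∈ Asub K n f) (v : Fin r → Asub K n f) :
    (fun i => (⟨mQ K n (f * Tvar K n - 1), hu⟩ : Asub K n f) * v i) ∈
      Submodule.span (Asub K n f)
        {v : Fin r → Asub K n f | ∃ k : Fin r,
          v = fun i : Fin r =>
            if i = k then (⟨mQ K n (f * Tvar K n - 1), hu⟩ : Asub K n f) else 0} := by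
  choose b hb hvb using fun i => exists_rabinowitsch_mul_eq f hfT (v i).2
  have hsum : (fun i => (⟨mQ K n (f * Tvar K n - 1), hu⟩ : Asub K n f) * v i) =
      ∑ k, (⟨b k, hb k⟩ : Asub K n f) • fun i : Fin r =>
        if i = k then (⟨mQ K n (f * Tvar K n - 1), hu⟩ : Asub K n f) else 0 := by
    funext i
    simp only [Finset.sum_apply, Pi.smul_apply, smul_eq_mul, mul_ite, mul_zero,
      Finset.sum_ite_eq, Finset.mem_univ, if_true]
    exact Subtype.ext (hvb i)
  rw [hsum]
  exact Submodule.sum_mem _ fun k _ => Submodule.smul_mem _ _ (Submodule.subset_span ⟨k, rfl⟩)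

theorem exists_pow_mul_mem_of_mem_saturationModulo (f : Qring K n) (hf : f ≠ 0)
    (hfT : pderiv (Sum.inr ()) f = 0) (hmf : mQ K n f ∈ Wsub K n f)
    (S : Submodule (Wsub K n f) (Fin r → Wsub K n f)) (L : Fin r → Wsub K n f)
    (h : (fun i => Subalgebra.inclusion (Wsub_le_Asub f) (L i)) ∈ saturationModulo f hfT S) :
    ∃ j : ℕ, (fun i => (⟨mQ K n f, hmf⟩ : Wsub K n f) ^ j * L i) ∈ S := by
  obtain ⟨M, s, hs, h⟩ := h
  refine ⟨M, ?_⟩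
  convert hs using 1
  funext i
  rw [← sub_eq_zero]
  refine Subtype.ext (eq_zero_of_forall_dvd f hf hfT (Subtype.property _) fun q => ?_)
  convert h i q using 1
  simp only [Subalgebra.coe_sub, Subalgebra.coe_mul, Subalgebra.coe_pow, LinearMap.sub_apply,
    Module.End.mul_apply, ← mQ_pow, mQ_apply, Subalgebra.coe_inclusion]

end Saturation

/-- The key lemma `S : (f)^∞ = (W[T]·S + U_f) ∩ W^r`: the saturation of a
`W`-submodule `S ⊆ W^r` with respect to `f` equals the intersection with `W^r`
of the `A`-module generated by `S` together with the Rabinowitsch relations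
`(fT-1)·e_k`. -/
theorem saturation_eq_rabinowitsch_intersection
    (hn : 0 < n) (f : Qring K n) (hf : f ≠ 0) (hfT : pderiv (Sum.inr ()) f = 0)
    (r : ℕ) (hr : 0 < r) :
    ∃ (hmf : LinearMap.mulLeft K f ∈ Wsub K n f)
      (hWA : Wsub K n f ≤ Asub K n f)
      (hu : mQ K n (f * Tvar K n - 1) ∈ Asub K n f),
      ∀ (S : Submodule (Wsub K n f) (Fin r → Wsub K n f)) (L : Fin r → Wsub K n f),
        (∃ j : ℕ,
            (fun i : Fin r => (⟨LinearMap.mulLeft K f, hmf⟩ : Wsub K n f) ^ j * L i) ∈ S) ↔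
        (fun i : Fin r => Subalgebra.inclusion hWA (L i)) ∈
          Submodule.span (Asub K n f)
            ((fun (v : Fin r → Wsub K n f) (i : Fin r) => Subalgebra.inclusion hWA (v i)) ''
              (S : Set (Fin r → Wsub K n f))) ⊔
          Submodule.span (Asub K n f)
            {v : Fin r → Asub K n f | ∃ k : Fin r,
              v = fun i : Fin r =>
                if i = k then (⟨mQ K n (f * Tvar K n - 1), hu⟩ : Asub K n f) else 0} := by
  obtain ⟨p, hp⟩ := exists_inclX_eq K n f hfT
  have hmf : mQ K n f ∈ Wsub K n f := hp ▸ mQ_inclX_mem_Wsub _ p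
  have hu := mQ_rabinowitsch_mem_Asub f hmf
  refine ⟨hmf, Wsub_le_Asub f, hu, fun S L => ⟨?_, fun h => ?_⟩⟩
  · rintro ⟨j, hj⟩
    induction j generalizing L with
    | zero => exact Submodule.mem_sup_left (Submodule.subset_span ⟨L, by simpa using hj, rfl⟩)
    | succ j ih =>
      let L' : Fin r → Wsub K n f := fun i => ⟨LinearMap.mulLeft K f, hmf⟩ * L i
      have hL' := ih L' (by simpa only [L', pow_succ, mul_assoc] using hj)
      have hTL := Submodule.smul_mem _ (⟨mQ K n (Tvar K n), mQ_Tvar_mem_Asub f⟩ : Asub K n f) hL'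
      have huL := Submodule.mem_sup_right (S := Submodule.span (Asub K n f)
        ((fun (v : Fin r → Wsub K n f) (i : Fin r) =>
          Subalgebra.inclusion (Wsub_le_Asub f) (v i)) '' (S : Set (Fin r → Wsub K n f))))
        (rabinowitsch_mul_mem_span f hfT hu
          fun i => Subalgebra.inclusion (Wsub_le_Asub f) (L i))
      convert Submodule.add_mem _ hTL (Submodule.smul_mem _
        (⟨-1, neg_mem (one_mem _)⟩ : Asub K n f) huL) using 1
      funext i
      refine Subtype.ext (LinearMap.ext fun q => ?_)
      simp only [L', Pi.add_apply, Pi.smul_apply, smul_eq_mul, Subalgebra.coe_add,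
        Subalgebra.coe_mul, Subalgebra.coe_inclusion, LinearMap.add_apply, LinearMap.neg_apply,
        Module.End.mul_apply, Module.End.one_apply, mQ_apply, LinearMap.mulLeft_apply]
      ring
  · refine exists_pow_mul_mem_of_mem_saturationModulo f hf hfT hmf S L
      ((sup_le (Submodule.span_le.2 ?_) (Submodule.span_le.2 ?_) :
        _ ≤ saturationModulo f hfT S) h)
    · rintro _ ⟨s, hs, rfl⟩
      exact ⟨0, s, hs, fun i q => by simp⟩
    · rintro _ ⟨k, rfl⟩
      refine ⟨0, 0, S.zero_mem, fun i q => ?_⟩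
      dsimp only
      split_ifs <;> simp [mQ_apply]

end
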